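/- Fix γ > 0, δ ≥ 0 and s ∈ (0,1]. Let H(u;γ,δ) = C(δ,γ)·(1+u)^{-(1+δ)}·(1+log(1+u))^{-(1+γ)} for u > 0, where C(δ,γ) > 0 is the normalizing constant making H(·;γ,δ) a probability density on (0,∞), and let f_δ(z) = (1-s)·φ(z;0,1) + s·∫₀^∞ φ(z;0,u)·H(u;γ,δ) du. Fix x ∈ ℝ^p and a function ω ↦ y(ω) with |y(ω)| → ∞ as ω → ∞. Then for every compact set K ⊂ ℝ^p × (0,∞), sup_{(β,σ) ∈ K} | f_δ((y(ω) − xᵀβ)/σ)/(σ·f_δ(y(ω))) − σ^{2δ} | → 0 as ω → ∞. In particular, the ratio converges to 1 uniformly on compact sets if and only if δ = 0. -/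

import Mathlib

open MeasureTheory Real Filter Set
open scoped RealInnerProductSpace

/-- Normal density with mean `0` and variance `u`. -/
noncomputable def normPdf (z u : ℝ) : ℝ :=
  (Real.sqrt (2 * Real.pi * u))⁻¹ * Real.exp (-(z ^ 2) / (2 * u))

/-- Unnormalized density of the generalized `H(·;γ,δ)` distribution:
`(1+u)^{-(1+δ)}·(1+log(1+u))^{-(1+γ)}`. -/
noncomputable def HdensShape (γ δ u : ℝ) : ℝ :=
  (1 + u) ^ (-(1 + δ)) * (1 + Real.log (1 + u)) ^ (-(1 + γ))

/-- The error density of the generalized class: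
`f_δ(z) = (1-s)·φ(z;0,1) + s·∫₀^∞ φ(z;0,u)·C·HdensShape(γ,δ,u) du`. -/
noncomputable def fGen (γ δ s C z : ℝ) : ℝ :=
  (1 - s) * normPdf z 1 +
    s * ∫ u in Set.Ioi (0:ℝ), normPdf z u * (C * HdensShape γ δ u)

theorem one_add_rpow_le_exp {A w : ℝ} (hA : 0 < A) (hw : 0 ≤ w) :
    (1 + w) ^ A ≤ (2 * A) ^ A * exp (1 / 2) * exp (w / 2) := by
  have h2 : (1 + w) / (2 * A) ≤ exp ((1 + w) / (2 * A)) := by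
    linarith [add_one_le_exp ((1 + w) / (2 * A))]
  have h3 : ((1 + w) / (2 * A)) ^ A ≤ exp ((1 + w) / 2) := by
    calc ((1 + w) / (2 * A)) ^ A ≤ (exp ((1 + w) / (2 * A))) ^ A := by gcongr
      _ = exp ((1 + w) / 2) := by
        rw [← exp_mul]; congr 1; field_simp
  rw [div_rpow (by positivity) (by positivity), div_le_iff₀ (by positivity)] at h3
  calc (1 + w) ^ A ≤ exp ((1 + w) / 2) * (2 * A) ^ A := h3
    _ = _ := by rw [add_div, exp_add]; ring

theorem one_add_rpow_mul_exp_le {A w : ℝ} (hA : 0 < A) (hw : 0 ≤ w) :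
    (1 + w) ^ A * exp (-(w / 2)) ≤ (2 * A) ^ A * exp (1 / 2) := by
  rw [exp_neg, ← div_eq_mul_inv, div_le_iff₀ (exp_pos _)]
  exact one_add_rpow_le_exp hA hw

/-- The reciprocal of the slowly varying factor of `HdensShape`. -/
noncomputable def logFactor (γ t : ℝ) : ℝ := (1 + log (1 + t)) ^ (1 + γ)

theorem one_le_one_add_log {t : ℝ} (ht : 0 ≤ t) : 1 ≤ 1 + log (1 + t) := by
  linarith [log_nonneg (by linarith : 1 ≤ 1 + t)]

theorem logFactor_pos (γ : ℝ) {t : ℝ} (ht : 0 ≤ t) : 0 < logFactor γ t :=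
  rpow_pos_of_pos (by linarith [one_le_one_add_log ht]) _

theorem logFactor_le {γ : ℝ} (hγ : 0 < γ) {t : ℝ} (ht : 0 ≤ t) :
    logFactor γ t ≤ (1 + t) ^ (1 + γ) := by
  have := one_le_one_add_log ht
  exact rpow_le_rpow (by linarith)
    (by linarith [log_le_sub_one_of_pos (by linarith : 0 < 1 + t)]) (by linarith)

theorem logFactor_div {γ t t' : ℝ} (ht : 0 ≤ t) (ht' : 0 ≤ t') :
    logFactor γ t / logFactor γ t' = ((1 + log (1 + t)) / (1 + log (1 + t'))) ^ (1 + γ) := by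
  have h1 := one_le_one_add_log ht
  have h2 := one_le_one_add_log ht'
  rw [logFactor, logFactor, div_rpow (by linarith) (by linarith)]

theorem log_one_add_le_of_le_mul {κ t t' : ℝ} (hκ : 1 ≤ κ) (ht : 0 ≤ t) (ht' : 0 ≤ t')
    (h : t ≤ κ * t') : log (1 + t) ≤ log κ + log (1 + t') := by
  rw [← log_mul (by linarith) (by linarith)]
  exact log_le_log (by linarith) (by nlinarith)

theorem logFactor_div_le {γ : ℝ} (hγ : 0 < γ) {t v : ℝ} (ht : 0 ≤ t) (hv : 0 < v) :
    logFactor γ t / logFactor γ (t * v) ≤ (1 + v⁻¹) ^ (1 + γ) := by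
  have hv' : 0 < v⁻¹ := inv_pos.2 hv
  have htv : 0 ≤ t * v := by positivity
  have h1 := one_le_one_add_log ht
  have h2 := one_le_one_add_log htv
  rw [logFactor_div ht htv]
  refine rpow_le_rpow (div_nonneg (by linarith) (by linarith)) ?_ (by linarith)
  have h3 : log (1 + t) ≤ log (1 + v⁻¹) + log (1 + t * v) := by
    refine log_one_add_le_of_le_mul (by linarith) ht htv ?_
    have : v⁻¹ * (t * v) = t := by field_simp
    nlinarith
  have h4 : log (1 + v⁻¹) ≤ v⁻¹ := by
    linarith [log_le_sub_one_of_pos (by linarith : 0 < 1 + v⁻¹)]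
  rw [div_le_iff₀ (by linarith)]
  nlinarith

/-- If two arguments tend to infinity while staying comparable, their logarithmic factors are
asymptotically equal. -/
theorem tendsto_logFactor_div {α : Type*} {l : Filter α} (γ : ℝ) {κ : ℝ} {t t' : α → ℝ}
    (hκ : 1 ≤ κ) (ht0 : ∀ᶠ a in l, 0 ≤ t a) (ht' : Tendsto t' l atTop)
    (h1 : ∀ᶠ a in l, t a ≤ κ * t' a) (h2 : ∀ᶠ a in l, t' a ≤ κ * t a) :
    Tendsto (fun a => logFactor γ (t a) / logFactor γ (t' a)) l (nhds 1) := by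
  have hh : Tendsto (fun a => 1 + log (1 + t' a)) l atTop :=
    tendsto_atTop_add_const_left _ _
      (tendsto_log_atTop.comp (tendsto_atTop_add_const_left _ _ ht'))
  have hr : Tendsto (fun a => (1 + log (1 + t a)) / (1 + log (1 + t' a))) l (nhds 1) := by
    have h0 : Tendsto (fun a => log κ / (1 + log (1 + t' a))) l (nhds 0) :=
      hh.const_div_atTop _
    refine tendsto_of_tendsto_of_tendsto_of_le_of_le'
      (g := fun a => 1 - log κ / (1 + log (1 + t' a)))
      (h := fun a => 1 + log κ / (1 + log (1 + t' a))) (by simpa using h0.const_sub 1)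
      (by simpa using h0.const_add 1) ?_ ?_
    · filter_upwards [ht0, ht'.eventually_ge_atTop 0, h2] with a ha ha' hb
      have := one_le_one_add_log ha'
      have := log_one_add_le_of_le_mul hκ ha' ha hb
      rw [le_div_iff₀ (by linarith), sub_mul, div_mul_cancel₀ _ (by linarith)]
      linarith
    · filter_upwards [ht0, ht'.eventually_ge_atTop 0, h1] with a ha ha' hb
      have := one_le_one_add_log ha'
      have := log_one_add_le_of_le_mul hκ ha ha' hb
      rw [div_le_iff₀ (by linarith), add_mul, div_mul_cancel₀ _ (by linarith)]
      linarith
  have := hr.rpow_const (p := 1 + γ) (Or.inl one_ne_zero)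
  rw [one_rpow] at this
  refine this.congr' ?_
  filter_upwards [ht0, ht'.eventually_ge_atTop 0] with a ha ha'
  rw [logFactor_div ha ha']

theorem HdensShape_eq {γ δ u : ℝ} (hu : 0 ≤ u) :
    HdensShape γ δ u = (1 + u) ^ (-(1 + δ)) / logFactor γ u := by
  have := one_le_one_add_log hu
  rw [HdensShape, logFactor, div_eq_mul_inv, rpow_neg (x := 1 + log (1 + u)) (by linarith)]

theorem normPdf_mul (z : ℝ) {t v : ℝ} (ht : 0 < t) (hz : z ^ 2 = t) :
    normPdf z (t * v) = t ^ (-(1 / 2) : ℝ) * normPdf 1 v := by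
  rw [normPdf, normPdf, rpow_neg ht.le, ← sqrt_eq_rpow,
    show 2 * π * (t * v) = t * (2 * π * v) by ring, sqrt_mul ht.le, mul_inv, hz, mul_assoc]
  congr 3
  by_cases hv : v = 0
  · simp [hv]
  · field_simp

theorem normPdf_one_le {v : ℝ} (hv : 0 < v) :
    normPdf 1 v ≤ v⁻¹ ^ (1 / 2 : ℝ) * exp (-(v⁻¹ / 2)) := by
  rw [normPdf, show -(1 ^ 2 : ℝ) / (2 * v) = -(v⁻¹ / 2) by field_simp]
  gcongr
  rw [inv_rpow hv.le, ← sqrt_eq_rpow]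
  gcongr
  nlinarith [pi_gt_three]

theorem normPdf_nonneg (z u : ℝ) : 0 ≤ normPdf z u := by
  unfold normPdf; positivity

theorem normPdf_pos (z : ℝ) {u : ℝ} (hu : 0 < u) : 0 < normPdf z u := by
  unfold normPdf; positivity

theorem measurable_normPdf (z : ℝ) : Measurable (normPdf z) := by
  unfold normPdf; fun_prop

theorem measurable_logFactor (γ : ℝ) : Measurable (logFactor γ) := by
  unfold logFactor; fun_prop

/-- The function dominating the rescaled mixture integrands. -/
theorem normPdf_mul_rpow_le {γ δ : ℝ} (hγ : 0 < γ) (hδ : 0 ≤ δ) {v : ℝ} (hv : 0 < v) :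
    normPdf 1 v * v⁻¹ ^ (1 + δ) * (1 + v⁻¹) ^ (1 + γ) ≤
      (2 * (4 + δ + γ)) ^ (4 + δ + γ) * exp (1 / 2) * (1 + v) ^ (-(3 / 2) : ℝ) := by
  have hw : 0 < v⁻¹ := inv_pos.2 hv
  set w := v⁻¹ with hw_def
  have hvw : (1 + v) ^ (-(3 / 2) : ℝ) = w ^ (3 / 2 : ℝ) * (1 + w) ^ (-(3 / 2) : ℝ) := by
    rw [rpow_neg (by positivity), rpow_neg (by positivity), ← inv_rpow (by positivity),
      ← inv_rpow (by positivity), ← mul_rpow (by positivity) (by positivity)]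
    congr 1
    rw [hw_def]; field_simp; ring
  have h1 := one_add_rpow_mul_exp_le (A := 4 + δ + γ) (by positivity) hw.le
  calc normPdf 1 v * w ^ (1 + δ) * (1 + w) ^ (1 + γ)
      ≤ (w ^ (1 / 2 : ℝ) * exp (-(w / 2))) * w ^ (1 + δ) * (1 + w) ^ (1 + γ) := by
        gcongr; exact normPdf_one_le hv
    _ = w ^ (3 / 2 : ℝ) * w ^ δ * (1 + w) ^ (1 + γ) * exp (-(w / 2)) := by
        rw [show w ^ (3 / 2 : ℝ) * w ^ δ = w ^ (1 / 2 : ℝ) * w ^ (1 + δ) by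
          rw [← rpow_add hw, ← rpow_add hw]; ring_nf]
        ring
    _ ≤ w ^ (3 / 2 : ℝ) * (1 + w) ^ δ * (1 + w) ^ (1 + γ) * exp (-(w / 2)) := by
        gcongr; linarith
    _ = w ^ (3 / 2 : ℝ) * ((1 + w) ^ (-(3 / 2) : ℝ) * (1 + w) ^ (5 / 2 + δ + γ)) *
          exp (-(w / 2)) * (1 : ℝ) := by
        rw [mul_assoc (w ^ _), ← rpow_add (by positivity), ← rpow_add (by positivity)]
        ring_nf
    _ ≤ w ^ (3 / 2 : ℝ) * ((1 + w) ^ (-(3 / 2) : ℝ) * (1 + w) ^ (4 + δ + γ)) *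
          exp (-(w / 2)) * (1 : ℝ) := by
        gcongr <;> linarith
    _ = ((1 + w) ^ (4 + δ + γ) * exp (-(w / 2))) *
          (w ^ (3 / 2 : ℝ) * (1 + w) ^ (-(3 / 2) : ℝ)) := by ring
    _ ≤ _ := by rw [hvw]; gcongr

theorem integrableOn_one_add_rpow :
    IntegrableOn (fun v : ℝ => (1 + v) ^ (-(3 / 2) : ℝ)) (Ioi 0) := by
  have := integrableOn_add_rpow_Ioi_of_lt (a := -(3 / 2)) (c := 0) (m := 1) (by norm_num)
    (by norm_num)
  simpa [add_comm] using this

theorem integrableOn_normPdf_mul_rpow {δ : ℝ} (hδ : 0 ≤ δ) :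
    IntegrableOn (fun v : ℝ => normPdf 1 v * v⁻¹ ^ (1 + δ)) (Ioi 0) := by
  refine (integrableOn_one_add_rpow.const_mul
    ((2 * (4 + δ + 1)) ^ (4 + δ + 1) * exp (1 / 2))).mono'
    (((measurable_normPdf 1).mul (by fun_prop)).aestronglyMeasurable) ?_
  refine (ae_restrict_mem measurableSet_Ioi).mono fun v (hv : 0 < v) => ?_
  have hn := normPdf_nonneg 1 v
  rw [norm_of_nonneg (by positivity)]
  refine le_trans ?_ (normPdf_mul_rpow_le one_pos hδ hv)
  exact le_mul_of_one_le_right (by positivity)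
    (one_le_rpow (by linarith [inv_pos.2 hv]) (by norm_num))

theorem integral_normPdf_mul_rpow_pos {δ : ℝ} (hδ : 0 ≤ δ) :
    0 < ∫ v in Ioi (0 : ℝ), normPdf 1 v * v⁻¹ ^ (1 + δ) := by
  have hpos : ∀ v ∈ Ioi (0 : ℝ), 0 < normPdf 1 v * v⁻¹ ^ (1 + δ) := fun v hv =>
    mul_pos (normPdf_pos 1 hv) (rpow_pos_of_pos (inv_pos.2 hv) _)
  rw [setIntegral_pos_iff_support_of_nonneg_ae
    ((ae_restrict_mem measurableSet_Ioi).mono fun v hv => (hpos v hv).le)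
    (integrableOn_normPdf_mul_rpow hδ)]
  have hsub : Ioi (0 : ℝ) ⊆ Function.support fun v => normPdf 1 v * v⁻¹ ^ (1 + δ) :=
    fun v hv => (hpos v hv).ne'
  rw [inter_eq_right.2 hsub]
  simp

theorem integral_mixture_rescale (γ : ℝ) {δ C z t : ℝ} (ht : 0 < t) (hz : z ^ 2 = t) :
    (∫ u in Ioi (0 : ℝ), normPdf z u * (C * HdensShape γ δ u)) *
        (t ^ (1 / 2 + δ) * logFactor γ t) =
      C * ∫ v in Ioi (0 : ℝ), normPdf 1 v * (t / (1 + t * v)) ^ (1 + δ) *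
        (logFactor γ t / logFactor γ (t * v)) := by
  have h := integral_comp_mul_left_Ioi (fun u => normPdf z u * (C * HdensShape γ δ u)) 0 ht
  rw [mul_zero, smul_eq_mul, eq_inv_mul_iff_mul_eq₀ ht.ne'] at h
  rw [← h, ← integral_const_mul, ← integral_const_mul, ← integral_mul_const]
  refine setIntegral_congr_fun measurableSet_Ioi fun v (hv : 0 < v) => ?_
  have htv : 0 < t * v := mul_pos ht hv
  have hp : t ^ (1 + δ) = t * t ^ (-(1 / 2) : ℝ) * t ^ (1 / 2 + δ) := by
    rw [mul_assoc, ← rpow_add ht, mul_comm, ← rpow_add_one ht.ne']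
    ring_nf
  rw [normPdf_mul z ht hz, HdensShape_eq htv.le, div_rpow ht.le (by positivity), hp,
    rpow_neg (x := t) (by positivity), rpow_neg (x := 1 + t * v) (by positivity)]
  ring

theorem tendsto_integral_mixture {γ δ : ℝ} (hγ : 0 < γ) (hδ : 0 ≤ δ) :
    Tendsto (fun t : ℝ => ∫ v in Ioi (0 : ℝ), normPdf 1 v * (t / (1 + t * v)) ^ (1 + δ) *
        (logFactor γ t / logFactor γ (t * v))) atTop
      (nhds (∫ v in Ioi (0 : ℝ), normPdf 1 v * v⁻¹ ^ (1 + δ))) := by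
  refine tendsto_integral_filter_of_dominated_convergence
    (fun v => (2 * (4 + δ + γ)) ^ (4 + δ + γ) * exp (1 / 2) * (1 + v) ^ (-(3 / 2) : ℝ))
    ?_ ?_ (integrableOn_one_add_rpow.const_mul _) ?_
  · refine Eventually.of_forall fun t => Measurable.aestronglyMeasurable ?_
    have h1 := measurable_normPdf 1
    have h2 := measurable_logFactor γ
    fun_prop
  · filter_upwards [eventually_gt_atTop 0] with t ht
    refine (ae_restrict_mem measurableSet_Ioi).mono fun v (hv : 0 < v) => ?_
    have hn := normPdf_nonneg 1 v
    have hL := logFactor_pos γ ht.le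
    have hL' := logFactor_pos γ (mul_pos ht hv).le
    rw [norm_of_nonneg (by positivity)]
    refine le_trans ?_ (normPdf_mul_rpow_le hγ hδ hv)
    gcongr
    · rw [div_le_iff₀ (by positivity)]
      have : v⁻¹ * (1 + t * v) = v⁻¹ + t := by field_simp
      rw [this]
      linarith [inv_pos.2 hv]
    · exact logFactor_div_le hγ ht.le hv
  · refine (ae_restrict_mem measurableSet_Ioi).mono fun v (hv : 0 < v) => ?_
    have h1 : Tendsto (fun t : ℝ => t / (1 + t * v)) atTop (nhds v⁻¹) := by
      have h : Tendsto (fun t : ℝ => (t⁻¹ + v)⁻¹) atTop (nhds v⁻¹) := by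
        simpa using (tendsto_inv_atTop_zero.add_const v).inv₀ (by simpa using hv.ne')
      refine h.congr' ?_
      filter_upwards [eventually_gt_atTop 0] with t ht
      field_simp
    have h2 : Tendsto (fun t : ℝ => logFactor γ t / logFactor γ (t * v)) atTop (nhds 1) := by
      refine tendsto_logFactor_div γ (κ := 1 + v + v⁻¹)
        (by linarith [inv_pos.2 hv]) (eventually_ge_atTop 0) (tendsto_id.atTop_mul_const hv) ?_ ?_
      · filter_upwards [eventually_ge_atTop 0] with t ht
        have : (1 + v + v⁻¹) * (t * v) = t * v + t * v * v + t := by field_simp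
        rw [this]
        have : 0 ≤ t * v + t * v * v := by positivity
        linarith
      · filter_upwards [eventually_ge_atTop 0] with t ht
        have := mul_nonneg ht (inv_pos.2 hv).le
        nlinarith
    simpa using ((h1.rpow_const (p := 1 + δ) (Or.inr (by linarith))).const_mul
      (normPdf 1 v)).mul h2

theorem tendsto_exp_mul_rpow_mul_logFactor {γ δ : ℝ} (hγ : 0 < γ) (hδ : 0 ≤ δ) :
    Tendsto (fun t : ℝ => exp (-(t / 2)) * (t ^ (1 / 2 + δ) * logFactor γ t)) atTop
      (nhds 0) := by
  have h0 : Tendsto (fun t : ℝ => (2 * (5 / 2 + δ + γ)) ^ (5 / 2 + δ + γ) * exp (1 / 2) /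
      (1 + t)) atTop (nhds 0) :=
    (tendsto_atTop_add_const_left _ _ tendsto_id).const_div_atTop _
  refine squeeze_zero' ?_ ?_ h0
  · filter_upwards [eventually_ge_atTop 0] with t ht
    have := logFactor_pos γ ht
    positivity
  · filter_upwards [eventually_ge_atTop 0] with t ht
    have hL := logFactor_pos γ ht
    rw [le_div_iff₀ (by positivity)]
    calc exp (-(t / 2)) * (t ^ (1 / 2 + δ) * logFactor γ t) * (1 + t)
        ≤ exp (-(t / 2)) * ((1 + t) ^ (1 / 2 + δ) * (1 + t) ^ (1 + γ)) * (1 + t) := by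
          gcongr
          · linarith
          · exact logFactor_le hγ ht
      _ = (1 + t) ^ (5 / 2 + δ + γ) * exp (-(t / 2)) := by
          rw [← rpow_add (by positivity), mul_assoc, ← rpow_add_one (by positivity)]
          ring_nf
      _ ≤ _ := one_add_rpow_mul_exp_le (by positivity) ht

/-- Exact tail order of the error density. -/
theorem tendsto_fGen_mul {γ δ : ℝ} (s C : ℝ) (hγ : 0 < γ) (hδ : 0 ≤ δ) {α : Type*} {l : Filter α}
    {z : α → ℝ} (hz : Tendsto (fun a => z a ^ 2) l atTop) :
    Tendsto (fun a => fGen γ δ s C (z a) * ((z a ^ 2) ^ (1 / 2 + δ) * logFactor γ (z a ^ 2))) l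
      (nhds (s * (C * ∫ v in Ioi (0 : ℝ), normPdf 1 v * v⁻¹ ^ (1 + δ)))) := by
  have h1 := ((tendsto_exp_mul_rpow_mul_logFactor hγ hδ).comp hz).const_mul
    ((1 - s) * (sqrt (2 * π * 1))⁻¹)
  have h2 := (((tendsto_integral_mixture hγ hδ).comp hz).const_mul C).const_mul s
  rw [mul_zero] at h1
  have h3 := h1.add h2
  rw [zero_add] at h3
  refine h3.congr' ?_
  filter_upwards [hz.eventually_gt_atTop 0] with a ha
  simp only [Function.comp_apply]
  rw [← integral_mixture_rescale γ ha rfl, fGen, normPdf, mul_one 2, neg_div]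
  ring

/-- For `z' = (y - m) / σ`, the density ratio is `σ ^ (2δ)` times a factor tending to one. -/
theorem fGen_ratio_eq {γ δ s C y m σ : ℝ} (hσ : 0 < σ) (hy : y ≠ 0) (hm : y - m ≠ 0) :
    fGen γ δ s C ((y - m) / σ) / (σ * fGen γ δ s C y) =
      σ ^ (2 * δ) *
        ((fGen γ δ s C ((y - m) / σ) *
            ((((y - m) / σ) ^ 2) ^ (1 / 2 + δ) * logFactor γ (((y - m) / σ) ^ 2))) /
          (fGen γ δ s C y * ((y ^ 2) ^ (1 / 2 + δ) * logFactor γ (y ^ 2))) *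
        ((y / (y - m)) ^ 2) ^ (1 / 2 + δ) *
        (logFactor γ (y ^ 2) / logFactor γ (((y - m) / σ) ^ 2))) := by
  have hL := (logFactor_pos γ (sq_nonneg y)).ne'
  have hL' := (logFactor_pos γ (sq_nonneg ((y - m) / σ))).ne'
  have hy2 : 0 < y ^ 2 := by positivity
  have hm2 : 0 < (y - m) ^ 2 := by positivity
  have hσp : (σ ^ 2) ^ (1 / 2 + δ) = σ * σ ^ (2 * δ) := by
    rw [← rpow_natCast, ← rpow_mul hσ.le, mul_comm σ, ← rpow_add_one hσ.ne']
    push_cast; ring_nf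
  have e1 : (((y - m) / σ) ^ 2) ^ (1 / 2 + δ) =
      ((y - m) ^ 2) ^ (1 / 2 + δ) / (σ * σ ^ (2 * δ)) := by
    rw [div_pow, div_rpow hm2.le (by positivity), hσp]
  have e2 : ((y / (y - m)) ^ 2) ^ (1 / 2 + δ) =
      (y ^ 2) ^ (1 / 2 + δ) / ((y - m) ^ 2) ^ (1 / 2 + δ) := by
    rw [div_pow, div_rpow hy2.le hm2.le]
  have hp1 := (rpow_pos_of_pos hy2 (1 / 2 + δ)).ne'
  have hp2 := (rpow_pos_of_pos hm2 (1 / 2 + δ)).ne'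
  have hp3 := (rpow_pos_of_pos hσ (2 * δ)).ne'
  rw [e1, e2]
  by_cases hf : fGen γ δ s C y = 0
  · simp [hf]
  generalize logFactor γ (((y - m) / σ) ^ 2) = L' at *
  generalize fGen γ δ s C ((y - m) / σ) = f' at *
  generalize ((y - m) ^ 2) ^ (1 / 2 + δ) = P' at *
  generalize (y ^ 2) ^ (1 / 2 + δ) = P at *
  generalize logFactor γ (y ^ 2) = L at *
  field_simp

theorem tendsto_div_sub_of_bounded {α : Type*} {l : Filter α} {y m : α → ℝ} {B : ℝ}
    (hy : Tendsto (fun a => |y a|) l atTop) (hm : ∀ᶠ a in l, |m a| ≤ B) :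
    Tendsto (fun a => y a / (y a - m a)) l (nhds 1) := by
  have h0 : Tendsto (fun a => m a / y a) l (nhds 0) := by
    refine squeeze_zero_norm' ?_ (hy.const_div_atTop B)
    filter_upwards [hm] with a ha
    rw [norm_eq_abs, abs_div]
    gcongr
  have h1 : Tendsto (fun a => (1 - m a / y a)⁻¹) l (nhds 1) := by
    simpa using (h0.const_sub 1).inv₀ (by norm_num)
  refine h1.congr' ?_
  filter_upwards [hy.eventually_gt_atTop 0] with a ha
  have : y a ≠ 0 := abs_pos.1 ha
  rw [one_sub_div this, inv_div]

theorem tendsto_fGen_ratio_sub {γ δ s C : ℝ} (hγ : 0 < γ) (hδ : 0 ≤ δ) (hs : 0 < s) (hC : 0 < C)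
    {α : Type*} {l : Filter α} {y m σ : α → ℝ} {A B D : ℝ}
    (hy : Tendsto (fun a => |y a|) l atTop) (hm : ∀ᶠ a in l, |m a| ≤ B)
    (hσ : ∀ᶠ a in l, 0 < σ a) (hσA : ∀ᶠ a in l, σ a ≤ A) (hσD : ∀ᶠ a in l, (σ a)⁻¹ ≤ D) :
    Tendsto (fun a => fGen γ δ s C ((y a - m a) / σ a) / (σ a * fGen γ δ s C (y a)) -
      σ a ^ (2 * δ)) l (nhds 0) := by
  have hr := tendsto_div_sub_of_bounded hy hm
  have hr2 : Tendsto (fun a => (y a / (y a - m a)) ^ 2) l (nhds 1) := by simpa using hr.pow 2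
  have hy2 : Tendsto (fun a => y a ^ 2) l atTop := by
    simpa [Function.comp_def] using
      (tendsto_pow_atTop (α := ℝ) two_ne_zero).comp hy
  have hy0 : ∀ᶠ a in l, y a ≠ 0 :=
    (hy.eventually_gt_atTop 0).mono fun a ha => abs_pos.1 ha
  have hm0 : ∀ᶠ a in l, y a - m a ≠ 0 := by
    filter_upwards [hr.eventually_const_lt one_pos] with a ha h
    simp [h] at ha
  have h1 : ∀ᶠ a in l, y a ^ 2 ≤ (1 + 2 * A ^ 2 + 2 * D ^ 2) * ((y a - m a) / σ a) ^ 2 := by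
    filter_upwards [hm0, hσ, hσA, hr2.eventually_lt_const one_lt_two] with a ha hs hA h2
    rw [div_pow, div_lt_iff₀ (by positivity)] at h2
    have e : (y a - m a) ^ 2 = σ a ^ 2 * ((y a - m a) / σ a) ^ 2 := by field_simp
    rw [e] at h2
    have : σ a ^ 2 ≤ A ^ 2 := by gcongr
    nlinarith [sq_nonneg ((y a - m a) / σ a), sq_nonneg D,
      mul_nonneg (sq_nonneg D) (sq_nonneg ((y a - m a) / σ a))]
  have h2 : ∀ᶠ a in l, ((y a - m a) / σ a) ^ 2 ≤ (1 + 2 * A ^ 2 + 2 * D ^ 2) * y a ^ 2 := by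
    filter_upwards [hm0, hσ, hσD, hr2.eventually_const_lt (show (1 / 2 : ℝ) < 1 by norm_num)]
      with a ha hs hD h2
    rw [div_pow, lt_div_iff₀ (by positivity)] at h2
    have : (σ a)⁻¹ ^ 2 ≤ D ^ 2 := by gcongr
    rw [div_eq_mul_inv, mul_pow]
    nlinarith [sq_nonneg (y a), mul_nonneg (sq_nonneg A) (sq_nonneg (y a)),
      mul_le_mul_of_nonneg_left this (sq_nonneg (y a - m a)), sq_nonneg D]
  have hκ : 1 ≤ 1 + 2 * A ^ 2 + 2 * D ^ 2 := by nlinarith [sq_nonneg A, sq_nonneg D]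
  have hz2 : Tendsto (fun a => ((y a - m a) / σ a) ^ 2) l atTop := by
    refine tendsto_atTop_mono' l ?_ (hy2.const_mul_atTop
      (show 0 < (1 + 2 * A ^ 2 + 2 * D ^ 2)⁻¹ by positivity))
    filter_upwards [h1] with a ha
    rwa [inv_mul_le_iff₀ (by positivity)]
  have hc : s * (C * ∫ v in Ioi (0 : ℝ), normPdf 1 v * v⁻¹ ^ (1 + δ)) ≠ 0 :=
    (mul_pos hs (mul_pos hC (integral_normPdf_mul_rpow_pos hδ))).ne'
  have hQ := (((tendsto_fGen_mul s C hγ hδ hz2).div (tendsto_fGen_mul s C hγ hδ hy2) hc).mul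
    (hr2.rpow_const (p := 1 / 2 + δ) (Or.inl one_ne_zero))).mul
    (tendsto_logFactor_div γ hκ (Eventually.of_forall fun a => sq_nonneg (y a)) hz2 h1 h2)
  rw [div_self hc, one_rpow, mul_one, mul_one] at hQ
  have hQ0 := (hQ.sub_const 1).norm.const_mul (A ^ (2 * δ))
  rw [sub_self, norm_zero, mul_zero] at hQ0
  refine squeeze_zero_norm' ?_ hQ0
  filter_upwards [hy0, hm0, hσ, hσA] with a ha1 ha2 hs hA
  rw [fGen_ratio_eq hs ha1 ha2, ← mul_sub_one, norm_mul, norm_of_nonneg (by positivity)]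
  simp only [Pi.div_apply]
  gcongr

/-- For the generalized heavy-tailed error density `f_δ` with outliers
`|y(ω)| → ∞`, the ratio `f_δ((y(ω) − xᵀβ)/σ)/(σ f_δ(y(ω)))` converges to
`σ^{2δ}` uniformly on every compact set `K ⊆ ℝ^p × (0,∞)`; in particular the
posterior robustness (limit `1`) holds exactly when `δ = 0`. -/
theorem fGen_ratio_tendstoUniformlyOn (p : ℕ) (γ δ s : ℝ) (hγ : 0 < γ) (hδ : 0 ≤ δ)
    (hs : s ∈ Set.Ioc (0:ℝ) 1) (C : ℝ) (hC : 0 < C)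
    (hCnorm : ∫ u in Set.Ioi (0:ℝ), C * HdensShape γ δ u = 1)
    (x : EuclideanSpace ℝ (Fin p)) (y : ℝ → ℝ)
    (hy : Filter.Tendsto (fun ω : ℝ => |y ω|) Filter.atTop Filter.atTop)
    (K : Set (EuclideanSpace ℝ (Fin p) × ℝ)) (hK : IsCompact K)
    (hKsub : K ⊆ Set.univ ×ˢ Set.Ioi (0:ℝ)) :
    TendstoUniformlyOn
      (fun ω : ℝ => fun q : EuclideanSpace ℝ (Fin p) × ℝ =>
        fGen γ δ s C ((y ω - ⟪x, q.1⟫) / q.2) / (q.2 * fGen γ δ s C (y ω)))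
      (fun q : EuclideanSpace ℝ (Fin p) × ℝ => q.2 ^ (2 * δ))
      Filter.atTop K := by
  have hpos : ∀ q ∈ K, 0 < q.2 := fun q hq => (hKsub hq).2
  obtain ⟨A, hA⟩ := hK.exists_bound_of_continuousOn (f := fun q => q.2) continuousOn_snd
  obtain ⟨D, hD⟩ := hK.exists_bound_of_continuousOn (f := fun q => q.2⁻¹)
    (continuousOn_snd.inv₀ fun q hq => (hpos q hq).ne')
  obtain ⟨B, hB⟩ := hK.exists_bound_of_continuousOn (f := fun q => (⟪x, q.1⟫ : ℝ))
    (by fun_prop)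
  have hmem : ∀ᶠ a : ℝ × (EuclideanSpace ℝ (Fin p) × ℝ) in atTop ×ˢ 𝓟 K, a.2 ∈ K :=
    tendsto_snd.eventually (mem_principal_self K)
  have h := tendsto_fGen_ratio_sub (y := fun a : ℝ × (EuclideanSpace ℝ (Fin p) × ℝ) => y a.1)
    (m := fun a => ⟪x, a.2.1⟫) (σ := fun a => a.2.2) hγ hδ hs.1 hC (hy.comp tendsto_fst)
    (hmem.mono fun a ha => hB _ ha) (hmem.mono fun a ha => hpos _ ha)
    (hmem.mono fun a ha => (le_abs_self _).trans (hA _ ha))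
    (hmem.mono fun a ha => (le_abs_self _).trans (hD _ ha))
  rw [tendstoUniformlyOn_iff_tendsto, tendsto_uniformity_iff_dist_tendsto_zero]
  refine h.norm.congr' (Eventually.of_forall fun a => ?_) |>.trans (by simp)
  rw [dist_comm, dist_eq_norm]
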